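/- Upper bound of the mending-volume theorem for propagation problems (Theorem 3.6, upper bound): Let Δ ≥ 1 and m ≥ 1 be natural numbers, let μ : Fin m → Fin m → ℕ with ∑_{l' : Fin m} μ l l' ≤ Δ for every l : Fin m, let M be the matrix of μ, and let l₀ : Fin m. Then there exists a partial labeling f : List (Fin Δ) → Option (Fin m) of the infinite Δ-regular rooted tree such that (i) f [] = some l₀, (ii) for every vertex v and every label l with f v = some l and every l' : Fin m, at least μ l l' of the children v ++ [i] satisfy f (v ++ [i]) = some l', and (iii) for every D : ℕ, the number of vertices v with v.length ≤ D and f v ≠ none is at most ∑_{d=0}^{D} ∑_{l' : Fin m} (M^d) l₀ l'. -/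

import Mathlib

theorem exists_childLabel {Δ m : ℕ} (k : Fin m → ℕ) (h : ∑ l', k l' ≤ Δ) :
    ∃ c : Fin Δ → Option (Fin m), ∀ l',
      (Finset.univ.filter (fun i : Fin Δ => c i = some l')).card = k l' := by
  classical
  have hc : Fintype.card (Σ l' : Fin m, Fin (k l')) ≤ Fintype.card (Fin Δ) := by
    simpa using h
  obtain ⟨e⟩ := Function.Embedding.nonempty_of_card_le hc
  refine ⟨fun i => (Function.partialInv e i).map Sigma.fst, fun l' => ?_⟩
  have : (Finset.univ.filter (fun i : Fin Δ =>
      (Function.partialInv e i).map Sigma.fst = some l')) =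
      (Finset.univ : Finset (Fin (k l'))).image (fun j => e ⟨l', j⟩) := by
    ext i
    simp only [Finset.mem_filter, Finset.mem_univ, true_and, Finset.mem_image,
      Option.map_eq_some_iff]
    constructor
    · rintro ⟨⟨a, j⟩, h1, rfl⟩
      exact ⟨j, (Function.partialInv_of_injective e.injective _ _).1 h1⟩
    · rintro ⟨j, rfl⟩
      exact ⟨⟨l', j⟩, Function.partialInv_left e.injective _, rfl⟩
  rw [this, Finset.card_image_of_injective]
  · simp
  · intro a b hab
    have := e.injective hab
    simpa using this

def treeLabel {Δ m : ℕ} (c : Fin m → Fin Δ → Option (Fin m)) (o : Option (Fin m))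
    (v : List (Fin Δ)) : Option (Fin m) :=
  v.foldl (fun o i => o.bind (fun l => c l i)) o

theorem treeLabel_none {Δ m : ℕ} (c : Fin m → Fin Δ → Option (Fin m))
    (v : List (Fin Δ)) : treeLabel c none v = none := by
  induction v with
  | nil => rfl
  | cons i v ih => simpa [treeLabel] using ih

def levelSet {Δ m : ℕ} (c : Fin m → Fin Δ → Option (Fin m)) :
    ℕ → Fin m → Finset (List (Fin Δ))
  | 0, _ => {[]}
  | d + 1, l => Finset.univ.biUnion fun l' =>
      (Finset.univ.filter (fun i : Fin Δ => c l i = some l')).biUnion fun i =>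
        (levelSet c d l').image (List.cons i)

theorem mem_levelSet {Δ m : ℕ} (c : Fin m → Fin Δ → Option (Fin m))
    (v : List (Fin Δ)) (l : Fin m) (h : treeLabel c (some l) v ≠ none) :
    v ∈ levelSet c v.length l := by
  induction v generalizing l with
  | nil => simp [levelSet]
  | cons i v ih =>
    have h' : treeLabel c (c l i) v ≠ none := h
    cases hc : c l i with
    | none => rw [hc, treeLabel_none] at h'; exact absurd rfl h'
    | some l' =>
      rw [hc] at h'
      simp only [List.length_cons, levelSet, Finset.mem_biUnion, Finset.mem_univ, true_and,
        Finset.mem_filter, Finset.mem_image]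
      exact ⟨l', i, hc, v, ih l' h', rfl⟩

theorem card_levelSet {Δ m : ℕ} (c : Fin m → Fin Δ → Option (Fin m))
    (M : Matrix (Fin m) (Fin m) ℕ)
    (hc : ∀ l l', (Finset.univ.filter (fun i : Fin Δ => c l i = some l')).card = M l l')
    (d : ℕ) (l : Fin m) : (levelSet c d l).card ≤ ∑ l', (M ^ d) l l' := by
  induction d generalizing l with
  | zero => simp [levelSet, Matrix.one_apply]
  | succ d ih =>
    calc (levelSet c (d + 1) l).card
        ≤ ∑ l', M l l' * (levelSet c d l').card := by
          refine Finset.card_biUnion_le.trans (Finset.sum_le_sum fun l' _ => ?_)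
          rw [← hc l l']
          exact Finset.card_biUnion_le_card_mul _ _ _ fun i _ => Finset.card_image_le
      _ ≤ ∑ l', M l l' * ∑ l'', (M ^ d) l' l'' :=
          Finset.sum_le_sum fun l' _ => Nat.mul_le_mul_left _ (ih l')
      _ = ∑ l', (M ^ (d + 1)) l l' := by
          simp only [pow_succ', Matrix.mul_apply, Finset.mul_sum]
          exact Finset.sum_comm

/-- Upper bound of the mending-volume theorem for propagation problems
(Theorem 3.6, upper bound). -/
theorem propagation_mending_volume_upper_bound
    (Δ m : ℕ) (hΔ : 1 ≤ Δ) (hm : 1 ≤ m)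
    (μ : Fin m → Fin m → ℕ)
    (hμΔ : ∀ l : Fin m, ∑ l' : Fin m, μ l l' ≤ Δ)
    (M : Matrix (Fin m) (Fin m) ℕ) (hM : ∀ l l', M l l' = μ l l')
    (l₀ : Fin m) :
    ∃ f : List (Fin Δ) → Option (Fin m),
      f [] = some l₀ ∧
      (∀ (v : List (Fin Δ)) (l : Fin m), f v = some l →
        ∀ l' : Fin m,
          μ l l' ≤ (Finset.univ.filter (fun i : Fin Δ => f (v ++ [i]) = some l')).card) ∧
      (∀ D : ℕ,
        {v : List (Fin Δ) | v.length ≤ D ∧ f v ≠ none}.ncard ≤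
          ∑ d ∈ Finset.range (D + 1), ∑ l' : Fin m, (M ^ d) l₀ l') := by
  choose c hc using fun l => exists_childLabel (μ l) (hμΔ l)
  refine ⟨treeLabel c (some l₀), rfl, ?_, ?_⟩
  · intro v l hv l'
    have h : ∀ i, treeLabel c (some l₀) (v ++ [i]) = c l i := by
      intro i
      have : treeLabel c (some l₀) (v ++ [i]) =
          (treeLabel c (some l₀) v).bind (fun l => c l i) := by
        simp [treeLabel, List.foldl_append]
      rw [this, hv]; rfl
    simp only [h]
    exact (hc l l').ge
  · intro D
    have hsub : {v : List (Fin Δ) | v.length ≤ D ∧ treeLabel c (some l₀) v ≠ none} ⊆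
        (((Finset.range (D + 1)).biUnion fun d => levelSet c d l₀ :
          Finset (List (Fin Δ))) : Set (List (Fin Δ))) := by
      rintro v ⟨h1, h2⟩
      simp only [Finset.mem_coe, Finset.mem_biUnion, Finset.mem_range]
      exact ⟨v.length, by omega, mem_levelSet c v l₀ h2⟩
    refine (Set.ncard_le_ncard hsub (Finset.finite_toSet _)).trans ?_
    rw [Set.ncard_coe_finset]
    exact Finset.card_biUnion_le.trans (Finset.sum_le_sum fun d _ =>
      card_levelSet c M (fun l l' => by rw [hc, hM]) d l₀)
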